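/- Let ξ ∈ h*/ℤR have zero central charge. Then (i) for every λ ∈ ξ there is an injective homomorphism of U-modules Δ(λ - h✓) ↪ Δ(λ) sending the highest weight generator v_{λ-h✓} to q·v_λ, and (ii) the category O[ξ] is indecomposable, i.e. it cannot be decomposed as a direct sum of two nonzero Serre subcategories. -/

import Mathlib

namespace Schrodinger

noncomputable section

open scoped TensorProduct

/-- Generators of the Schrödinger algebra. -/
inductive Gen : Type
  | E | H | F | P | Q | Z
  deriving DecidableEq

/-- The free algebra on the generators. -/
abbrev FA : Type := FreeAlgebra ℂ Gen

/-- Inclusion of generators. -/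
def ιg (g : Gen) : FA := FreeAlgebra.ι ℂ g

/-- The defining relations of the universal enveloping algebra of the Schrödinger
algebra `s`: `z` is central and `[h,e]=2e`, `[e,f]=h`, `[h,f]=-2f`, `[e,q]=p`,
`[e,p]=0`, `[h,p]=p`, `[f,p]=q`, `[f,q]=0`, `[h,q]=-q`, `[p,q]=z`. -/
inductive Rel : FA → FA → Prop
  | he : Rel (ιg .H * ιg .E) (ιg .E * ιg .H + 2 * ιg .E)
  | ef : Rel (ιg .E * ιg .F) (ιg .F * ιg .E + ιg .H)
  | hf : Rel (ιg .H * ιg .F) (ιg .F * ιg .H - 2 * ιg .F)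
  | eq : Rel (ιg .E * ιg .Q) (ιg .Q * ιg .E + ιg .P)
  | ep : Rel (ιg .E * ιg .P) (ιg .P * ιg .E)
  | hp : Rel (ιg .H * ιg .P) (ιg .P * ιg .H + ιg .P)
  | fp : Rel (ιg .F * ιg .P) (ιg .P * ιg .F + ιg .Q)
  | fq : Rel (ιg .F * ιg .Q) (ιg .Q * ιg .F)
  | hq : Rel (ιg .H * ιg .Q) (ιg .Q * ιg .H - ιg .Q)
  | pq : Rel (ιg .P * ιg .Q) (ιg .Q * ιg .P + ιg .Z)
  | ze : Rel (ιg .Z * ιg .E) (ιg .E * ιg .Z)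
  | zh : Rel (ιg .Z * ιg .H) (ιg .H * ιg .Z)
  | zf : Rel (ιg .Z * ιg .F) (ιg .F * ιg .Z)
  | zp : Rel (ιg .Z * ιg .P) (ιg .P * ιg .Z)
  | zq : Rel (ιg .Z * ιg .Q) (ιg .Q * ιg .Z)

/-- The universal enveloping algebra `U = U(s)` of the Schrödinger algebra,
presented by generators and relations (via the PBW theorem). -/
abbrev U : Type := RingQuot Rel

/-- The generators of `U`. -/
def gen (g : Gen) : U := RingQuot.mkAlgHom ℂ Rel (ιg g)

def E : U := gen .E
def H : U := gen .H
def F : U := gen .F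
def P : U := gen .P
def Q : U := gen .Q
def Z : U := gen .Z

/-- Scalars inside `U`. -/
def sc (a : ℂ) : U := algebraMap ℂ U a

/-- The Casimir element `c = (h² + h + 4fe)z − 2(fp² − eq² − hpq)`. -/
def cElt : U := (H * H + H + 4 * (F * E)) * Z - 2 * (F * (P * P) - E * (Q * Q) - H * (P * Q))

/-- The left ideal of `U` defining the Verma module `Δ(λ)` for
`λ ∈ 𝔥*` with `λ(h) = hh`, `λ(z) = zz`:  it is generated by `n₊ = span{e,p}`
together with `h - λ(h)` and `z - λ(z)`; then
`Δ(λ) = U ⊗_{U(𝔟)} ℂ_λ ≅ U / U(e, p, h - λ(h), z - λ(z))`. -/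
def vermaIdeal (hh zz : ℂ) : Submodule U U :=
  Submodule.span U ({E, P, H - sc hh, Z - sc zz} : Set U)

/-- The Verma module `Δ(λ)` with highest weight `λ`, `λ(h) = hh`, `λ(z) = zz`. -/
abbrev Verma (hh zz : ℂ) : Type := U ⧸ vermaIdeal hh zz

/-- The canonical highest weight generator `v_λ` of `Δ(λ)`. -/
def hwVec (hh zz : ℂ) : Verma hh zz := Submodule.Quotient.mk 1

/-- The unique maximal submodule `K(λ)` of `Δ(λ)`. -/
def vermaRad (hh zz : ℂ) : Submodule U (Verma hh zz) := sSup {N : Submodule U (Verma hh zz) | N ≠ ⊤}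

/-- The simple highest weight module `L(λ) = Δ(λ)/K(λ)`. -/
abbrev SimpleHW (hh zz : ℂ) : Type := Verma hh zz ⧸ vermaRad hh zz

/-- The scalar `ϑ_λ = (λ(h)² + 3λ(h) + 2)·λ(z)` by which the Casimir element `c`
acts on the Verma module `Δ(λ)`. -/
def vartheta (hh zz : ℂ) : ℂ := (hh ^ 2 + 3 * hh + 2) * zz

end

end Schrodinger

namespace Schrodinger

noncomputable section

open CategoryTheory

/-- The `ℂ`-vector space structure on a `U`-module, obtained by restricting
scalars along `ℂ → U`. -/
def cmod (M : Type) [AddCommGroup M] [Module U M] : Module ℂ M :=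
  Module.compHom M (algebraMap ℂ U)

/-- `v` is a weight vector of weight `λ` with `λ(h) = hh` and `λ(z) = zz`. -/
def IsWeightVec {M : Type} [AddCommGroup M] [Module U M] (hh zz : ℂ) (v : M) : Prop :=
  H • v = sc hh • v ∧ Z • v = sc zz • v

/-- The subalgebra `U(n₊)` of `U` generated by `n₊ = span{e, p}`. -/
def nPlus : Subalgebra ℂ U := Algebra.adjoin ℂ ({E, P} : Set U)

/-- Membership in category `O`: finitely generated, a (direct) sum of its
weight spaces, and locally `U(n₊)`-finite. -/
def InO (M : Type) [AddCommGroup M] [Module U M] : Prop :=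
  Module.Finite U M ∧
  (∀ v : M, v ∈ AddSubgroup.closure {w : M | ∃ hh zz : ℂ, IsWeightVec hh zz w}) ∧
  (letI := cmod M
   ∀ v : M, ∃ W : Submodule ℂ M, FiniteDimensional ℂ W ∧ ∀ u ∈ nPlus, u • v ∈ W)

/-- Membership in the block `O[ξ]`, where `ξ ∈ 𝔥*/ℤR` is the class of the weight
`(hh0, zz0)` (so that the weights in `ξ` are exactly `(hh0 + n, zz0)`, `n ∈ ℤ`):
the module is in `O` and all its weights lie in `ξ`. -/
def InBlock (hh0 zz0 : ℂ) (M : ModuleCat.{0} U) : Prop :=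
  InO M ∧
  ∀ (v : M) (hh zz : ℂ), v ≠ 0 → IsWeightVec hh zz v → zz = zz0 ∧ ∃ n : ℤ, hh = hh0 + n

/-- The Verma module as an object of the category of `U`-modules. -/
def VermaC (hh zz : ℂ) : ModuleCat.{0} U := ModuleCat.of U (Verma hh zz)

/-- `Pc` is a Serre class inside the subcategory (of the category of `U`-modules)
cut out by `Oc`: it is contained in `Oc`, closed under isomorphism, and for every
short exact sequence `0 → N → M → M/N → 0` in `Oc`, `M` belongs to `Pc` if and only
if both `N` and `M/N` do. -/
def SerreClassIn (Oc Pc : ModuleCat.{0} U → Prop) : Prop :=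
  (∀ M, Pc M → Oc M) ∧
  (∀ M N : ModuleCat.{0} U, Nonempty ((M : Type) ≃ₗ[U] (N : Type)) → Pc M → Oc N → Pc N) ∧
  (∀ (M : ModuleCat.{0} U) (N : Submodule U M), Oc M →
      (Pc M ↔ Pc (ModuleCat.of U N) ∧ Pc (ModuleCat.of U ((M : Type) ⧸ N))))

/-- Membership in the Serre subcategory of the subcategory cut out by `Oc`
generated by the set of objects `S`. -/
def InSerreGen (Oc : ModuleCat.{0} U → Prop) (S : Set (ModuleCat.{0} U))
    (M : ModuleCat.{0} U) : Prop :=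
  Oc M ∧ ∀ Pc : ModuleCat.{0} U → Prop, SerreClassIn Oc Pc → (∀ X ∈ S, Pc X) → Pc M

end

end Schrodinger

namespace Schrodinger

noncomputable section

/-! ### Relations in `U` -/

theorem mk_eq_of_rel {a b : FA} (h : Rel a b) :
    RingQuot.mkAlgHom ℂ Rel a = RingQuot.mkAlgHom ℂ Rel b :=
  RingQuot.mkAlgHom_rel ℂ h

theorem H_mul_E : H * E = E * H + 2 * E := by
  simpa [H, E, gen, two_mul] using mk_eq_of_rel Rel.he

theorem E_mul_F : E * F = F * E + H := by
  simpa [H, E, F, gen] using mk_eq_of_rel Rel.ef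

theorem H_mul_F : H * F = F * H - 2 * F := by
  simpa [H, F, gen, two_mul] using mk_eq_of_rel Rel.hf

theorem E_mul_Q : E * Q = Q * E + P := by
  simpa [E, Q, P, gen] using mk_eq_of_rel Rel.eq

theorem E_mul_P : E * P = P * E := by
  simpa [E, P, gen] using mk_eq_of_rel Rel.ep

theorem H_mul_P : H * P = P * H + P := by
  simpa [H, P, gen] using mk_eq_of_rel Rel.hp

theorem F_mul_P : F * P = P * F + Q := by
  simpa [F, P, Q, gen] using mk_eq_of_rel Rel.fp

theorem F_mul_Q : F * Q = Q * F := by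
  simpa [F, Q, gen] using mk_eq_of_rel Rel.fq

theorem H_mul_Q : H * Q = Q * H - Q := by
  simpa [H, Q, gen] using mk_eq_of_rel Rel.hq

theorem P_mul_Q : P * Q = Q * P + Z := by
  simpa [P, Q, Z, gen] using mk_eq_of_rel Rel.pq

theorem Z_mul_gen (g : Gen) : Z * gen g = gen g * Z := by
  cases g
  · simpa [Z, gen] using mk_eq_of_rel Rel.ze
  · simpa [Z, gen] using mk_eq_of_rel Rel.zh
  · simpa [Z, gen] using mk_eq_of_rel Rel.zf
  · simpa [Z, gen] using mk_eq_of_rel Rel.zp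
  · simpa [Z, gen] using mk_eq_of_rel Rel.zq
  · rfl

/-- `U` is generated by the images of the generators. -/
theorem U_induction {C : U → Prop} (u : U) (scalar : ∀ a : ℂ, C (algebraMap ℂ U a))
    (generator : ∀ g, C (gen g)) (mul : ∀ a b, C a → C b → C (a * b))
    (add : ∀ a b, C a → C b → C (a + b)) : C u := by
  obtain ⟨x, rfl⟩ := RingQuot.mkAlgHom_surjective ℂ Rel u
  induction x using FreeAlgebra.induction with
  | grade0 r => simpa using scalar r
  | grade1 g => exact generator g
  | mul a b ha hb => simpa using mul _ _ ha hb
  | add a b ha hb => simpa using add _ _ ha hb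

/-! ### The polynomial model of the Verma module -/

/-- The action of the generators on the span of the symbols `f ^ i q ^ j v`, where `v` is a
highest weight vector of weight `hh` and central charge zero. -/
def modelOp (hh : ℂ) : Gen → Module.End ℂ (ℕ × ℕ →₀ ℂ)
  | .E => Finsupp.linearCombination ℂ fun
      | (0, _) => 0
      | (i + 1, j) => Finsupp.single (i, j) ((i + 1 : ℂ) * (hh - j - i))
  | .H => Finsupp.linearCombination ℂ fun x => Finsupp.single x (hh - 2 * x.1 - x.2)
  | .F => Finsupp.linearCombination ℂ fun x => Finsupp.single (x.1 + 1, x.2) 1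
  | .P => Finsupp.linearCombination ℂ fun
      | (0, _) => 0
      | (i + 1, j) => Finsupp.single (i, j + 1) (-(i + 1 : ℂ))
  | .Q => Finsupp.linearCombination ℂ fun x => Finsupp.single (x.1, x.2 + 1) 1
  | .Z => 0

theorem modelOp_rel (hh : ℂ) {a b : FA} (h : Rel a b) :
    FreeAlgebra.lift ℂ (modelOp hh) a = FreeAlgebra.lift ℂ (modelOp hh) b := by
  cases h <;>
  · simp only [map_mul, map_add, map_sub, ιg, FreeAlgebra.lift_ι_apply, map_ofNat]
    refine Finsupp.lhom_ext' fun ⟨i, j⟩ => LinearMap.ext_ring ?_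
    rcases i with _ | _ | i <;>
    · simp [-Finsupp.single_mul, modelOp, Module.End.mul_apply, Module.End.ofNat_apply, ← Finsupp.single_add,
        ← Finsupp.single_sub, ← Finsupp.single_neg]
      try ring_nf

/-- The representation of `U` on the polynomial model. -/
def modelRep (hh : ℂ) : U →ₐ[ℂ] Module.End ℂ (ℕ × ℕ →₀ ℂ) :=
  RingQuot.liftAlgHom ℂ ⟨FreeAlgebra.lift ℂ (modelOp hh), fun _ _ h => modelOp_rel hh h⟩

theorem modelRep_gen (hh : ℂ) (g : Gen) : modelRep hh (gen g) = modelOp hh g := by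
  simp [modelRep, gen, ιg]

/-- The polynomial model of the Verma module of highest weight `hh` and central charge zero. -/
def Model (_hh : ℂ) : Type := ℕ × ℕ →₀ ℂ

instance (hh : ℂ) : AddCommGroup (Model hh) := inferInstanceAs (AddCommGroup (ℕ × ℕ →₀ ℂ))

instance (hh : ℂ) : Module ℂ (Model hh) := inferInstanceAs (Module ℂ (ℕ × ℕ →₀ ℂ))

instance (hh : ℂ) : Module U (Model hh) :=
  Module.compHom (ℕ × ℕ →₀ ℂ) (modelRep hh).toRingHom

namespace Model

theorem smul_def {hh : ℂ} (u : U) (m : Model hh) : u • m = modelRep hh u m := rfl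

theorem gen_smul {hh : ℂ} (g : Gen) (m : Model hh) : gen g • m = modelOp hh g m := by
  rw [smul_def, modelRep_gen]

theorem sc_smul {hh : ℂ} (a : ℂ) (m : Model hh) : sc a • m = a • m := by
  rw [smul_def, sc, AlgHom.commutes]
  rfl

theorem cmod_eq (hh : ℂ) : cmod (Model hh) = inferInstanceAs (Module ℂ (Model hh)) :=
  Module.ext (by ext a m; exact sc_smul a m)

/-- The basis vector `f ^ i q ^ j v`. -/
def mon (hh : ℂ) (i j : ℕ) : Model hh := Finsupp.single (i, j) (1 : ℂ)

theorem mon_ne_zero (hh : ℂ) (i j : ℕ) : mon hh i j ≠ 0 :=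
  Finsupp.single_ne_zero.mpr one_ne_zero

variable {hh : ℂ} (i j : ℕ)

theorem F_smul_mon : F • mon hh i j = mon hh (i + 1) j := by
  rw [F, gen_smul]; simp [modelOp, mon]; rfl

theorem Q_smul_mon : Q • mon hh i j = mon hh i (j + 1) := by
  rw [Q, gen_smul]; simp [modelOp, mon]; rfl

theorem Z_smul (m : Model hh) : Z • m = 0 := by
  rw [Z, gen_smul]; rfl

theorem E_smul_mon_zero : E • mon hh 0 j = 0 := by
  rw [E, gen_smul]; simp [modelOp, mon]; rfl

theorem P_smul_mon_zero : P • mon hh 0 j = 0 := by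
  rw [P, gen_smul]; simp [modelOp, mon]; rfl

theorem E_smul_mon_succ :
    E • mon hh (i + 1) j = ((i + 1 : ℂ) * (hh - j - i)) • mon hh i j := by
  rw [E, gen_smul]
  exact (by simp [modelOp] : modelOp hh .E (Finsupp.single (i + 1, j) 1) =
    ((i + 1 : ℂ) * (hh - j - i)) • Finsupp.single (i, j) 1)

theorem P_smul_mon_succ :
    P • mon hh (i + 1) j = (-(i + 1 : ℂ)) • mon hh i (j + 1) := by
  rw [P, gen_smul]
  exact (by simp [modelOp] : modelOp hh .P (Finsupp.single (i + 1, j) 1) =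
    (-(i + 1 : ℂ)) • Finsupp.single (i, j + 1) 1)

theorem H_smul_mon :
    H • mon hh i j = (hh - 2 * i - j) • mon hh i j := by
  rw [H, gen_smul]
  exact (by simp [modelOp] : modelOp hh .H (Finsupp.single (i, j) 1) =
    (hh - 2 * i - j) • Finsupp.single (i, j) 1)

theorem H_smul_apply (m : Model hh) (x : ℕ × ℕ) :
    (show ℕ × ℕ →₀ ℂ from H • m) x = (hh - 2 * x.1 - x.2) * (show ℕ × ℕ →₀ ℂ from m) x := by
  rw [H, gen_smul]
  change (modelOp hh .H m) x = _
  induction m using Finsupp.induction_linear with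
  | zero => simp
  | add f g hf hg =>
    rw [map_add, Finsupp.add_apply, hf, hg, ← mul_add]; rfl
  | single y a =>
    by_cases h : y = x
    · subst h; simp [modelOp, mul_comm]
    · simp [modelOp, h]

theorem induction {C : Model hh → Prop} (m : Model hh) (zero : C 0)
    (add : ∀ x y, C x → C y → C (x + y)) (smul_mon : ∀ (a : ℂ) (i j), C (a • mon hh i j)) :
    C m := by
  induction m using Finsupp.induction_linear with
  | zero => exact zero
  | add f g hf hg => exact add f g hf hg
  | single x a =>
    have h : (Finsupp.single x a : ℕ × ℕ →₀ ℂ) = a • Finsupp.single x 1 := by simp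
    rw [h]
    exact smul_mon a x.1 x.2

instance : IsScalarTower ℂ U (Model hh) where
  smul_assoc a u m := by rw [smul_def, smul_def, map_smul]; rfl

end Model

/-! ### The universal property of the model -/

section Lift

variable {M : Type} [AddCommGroup M] [Module U M]

/-- `v` is annihilated by `n₊` and is a weight vector of central charge zero. -/
structure IsHighestWeight (hh : ℂ) (v : M) : Prop where
  E_smul : E • v = 0
  P_smul : P • v = 0
  H_smul : H • v = sc hh • v
  Z_smul : Z • v = 0

theorem Z_mul_comm (u : U) : Z * u = u * Z := by
  induction u using U_induction with
  | scalar a => exact (Algebra.commutes a Z).symm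
  | generator g => exact Z_mul_gen g
  | mul a b ha hb => rw [← mul_assoc, ha, mul_assoc, hb, mul_assoc]
  | add a b ha hb => rw [mul_add, ha, hb, add_mul]

theorem Z_smul_comm (u : U) (m : M) : Z • u • m = u • Z • m := by
  rw [← mul_smul, Z_mul_comm, mul_smul]

theorem E_smul_F_smul (m : M) : E • F • m = F • E • m + H • m := by
  simp only [← mul_smul, E_mul_F, add_smul]

theorem H_smul_F_smul (m : M) : H • F • m = F • H • m - (2 : ℕ) • F • m := by
  simp only [← mul_smul, H_mul_F, sub_smul, two_mul, add_smul, two_nsmul]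

theorem P_smul_F_smul (m : M) : P • F • m = F • P • m - Q • m := by
  simp only [← mul_smul, F_mul_P, add_smul, add_sub_cancel_right]

theorem E_smul_Q_smul (m : M) : E • Q • m = Q • E • m + P • m := by
  simp only [← mul_smul, E_mul_Q, add_smul]

theorem H_smul_Q_smul (m : M) : H • Q • m = Q • H • m - Q • m := by
  simp only [← mul_smul, H_mul_Q, sub_smul]

theorem P_smul_Q_smul (m : M) : P • Q • m = Q • P • m + Z • m := by
  simp only [← mul_smul, P_mul_Q, add_smul]

namespace IsHighestWeight

theorem Z_smul_smul {hh : ℂ} {v : M} (hv : IsHighestWeight hh v) (u : U) : Z • u • v = 0 := by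
  rw [Z_smul_comm, hv.Z_smul, smul_zero]

theorem P_smul_Q_pow {hh : ℂ} {v : M} (hv : IsHighestWeight hh v) (j : ℕ) :
    P • Q ^ j • v = 0 := by
  induction j with
  | zero => simpa using hv.P_smul
  | succ j ih => rw [pow_succ', mul_smul, P_smul_Q_smul, ih, hv.Z_smul_smul, smul_zero, add_zero]

theorem E_smul_Q_pow {hh : ℂ} {v : M} (hv : IsHighestWeight hh v) (j : ℕ) :
    E • Q ^ j • v = 0 := by
  induction j with
  | zero => simpa using hv.E_smul
  | succ j ih => rw [pow_succ', mul_smul, E_smul_Q_smul, ih, hv.P_smul_Q_pow, smul_zero, add_zero]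

variable [Module ℂ M]

/-- The `ℂ`-linear map from the model sending `f ^ i q ^ j v` to the corresponding vector. -/
def toLinear (hh : ℂ) (v : M) : Model hh →ₗ[ℂ] M :=
  Finsupp.linearCombination ℂ fun x : ℕ × ℕ => F ^ x.1 • Q ^ x.2 • v

theorem toLinear_mon (hh : ℂ) (v : M) (i j : ℕ) :
    toLinear hh v (Model.mon hh i j) = F ^ i • Q ^ j • v :=
  (Finsupp.linearCombination_single ℂ _ _).trans (one_smul _ _)

variable [IsScalarTower ℂ U M]

theorem H_smul_monomial {hh : ℂ} {v : M} (hv : IsHighestWeight hh v) (i j : ℕ) :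
    H • F ^ i • Q ^ j • v = (hh - 2 * i - j) • F ^ i • Q ^ j • v := by
  induction i with
  | zero =>
    induction j with
    | zero => simpa [sc, algebraMap_smul] using hv.H_smul
    | succ j ih =>
      simp only [pow_zero, one_smul] at ih ⊢
      rw [pow_succ', mul_smul, H_smul_Q_smul, ih, smul_comm Q]
      generalize Q • Q ^ j • v = w
      push_cast
      module
  | succ i ih =>
    rw [pow_succ', mul_smul, H_smul_F_smul, ih, smul_comm F]
    generalize F • F ^ i • Q ^ j • v = w
    push_cast
    module

theorem P_smul_monomial {hh : ℂ} {v : M} (hv : IsHighestWeight hh v) (i j : ℕ) :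
    P • F ^ (i + 1) • Q ^ j • v = (-(i + 1 : ℂ)) • F ^ i • Q ^ (j + 1) • v := by
  have hQ (i : ℕ) : Q • F ^ i • Q ^ j • v = F ^ i • Q ^ (j + 1) • v := by
    rw [← mul_smul, ← mul_smul, ← mul_smul, pow_succ', ← mul_assoc,
      ((show Commute F Q from F_mul_Q).pow_left i).eq]
  induction i with
  | zero => simp [P_smul_F_smul, hv.P_smul_Q_pow, pow_succ', mul_smul]
  | succ i ih =>
    rw [pow_succ', mul_smul, P_smul_F_smul, ih, smul_comm F, ← mul_smul F, ← pow_succ', hQ]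
    generalize F ^ (i + 1) • Q ^ (j + 1) • v = w
    push_cast
    module

theorem E_smul_monomial {hh : ℂ} {v : M} (hv : IsHighestWeight hh v) (i j : ℕ) :
    E • F ^ (i + 1) • Q ^ j • v = ((i + 1 : ℂ) * (hh - j - i)) • F ^ i • Q ^ j • v := by
  induction i with
  | zero =>
    have := hv.H_smul_monomial 0 j
    simp only [pow_zero, one_smul] at this
    simp [E_smul_F_smul, hv.E_smul_Q_pow, this]
  | succ i ih =>
    rw [pow_succ', mul_smul, E_smul_F_smul, ih, smul_comm F, ← mul_smul F, ← pow_succ',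
      hv.H_smul_monomial]
    generalize F ^ (i + 1) • Q ^ j • v = w
    push_cast
    module

theorem toLinear_gen_smul {hh : ℂ} {v : M} (hv : IsHighestWeight hh v) (g : Gen)
    (m : Model hh) : toLinear hh v (gen g • m) = gen g • toLinear hh v m := by
  induction m using Model.induction with
  | zero => simp
  | add x y hx hy => simp only [smul_add, map_add, hx, hy]
  | smul_mon a i j =>
    rw [smul_comm, (toLinear hh v).map_smul a, (toLinear hh v).map_smul a, smul_comm (gen g),
      toLinear_mon]
    congr 1
    cases g
    · change toLinear hh v (E • _) = E • _
      cases i with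
      | zero => simp [Model.E_smul_mon_zero, hv.E_smul_Q_pow]
      | succ i => rw [Model.E_smul_mon_succ, map_smul, toLinear_mon, hv.E_smul_monomial]
    · change toLinear hh v (H • _) = H • _
      rw [Model.H_smul_mon, map_smul, toLinear_mon, hv.H_smul_monomial]
    · change toLinear hh v (F • _) = F • _
      rw [Model.F_smul_mon, toLinear_mon, pow_succ', mul_smul]
    · change toLinear hh v (P • _) = P • _
      cases i with
      | zero => simp [Model.P_smul_mon_zero, hv.P_smul_Q_pow]
      | succ i => rw [Model.P_smul_mon_succ, map_smul, toLinear_mon, hv.P_smul_monomial]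
    · change toLinear hh v (Q • _) = Q • _
      rw [Model.Q_smul_mon, toLinear_mon, pow_succ', ← mul_smul, ← mul_smul, ← mul_smul,
        ← mul_assoc, ((show Commute F Q from F_mul_Q).pow_left i).eq, mul_assoc]
    · change toLinear hh v (Z • _) = Z • _
      rw [Model.Z_smul, map_zero, ← mul_smul (F ^ i), hv.Z_smul_smul]

theorem toLinear_smul {hh : ℂ} {v : M} (hv : IsHighestWeight hh v) (u : U)
    (m : Model hh) : toLinear hh v (u • m) = u • toLinear hh v m := by
  induction u using U_induction generalizing m with
  | scalar a => rw [algebraMap_smul, algebraMap_smul, map_smul]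
  | generator g => exact hv.toLinear_gen_smul g m
  | mul a b ha hb => rw [mul_smul, ha, hb, mul_smul]
  | add a b ha hb => rw [add_smul, map_add, ha, hb, add_smul]

end IsHighestWeight

theorem cmod_isScalarTower (M : Type) [AddCommGroup M] [Module U M] :
    letI := cmod M
    IsScalarTower ℂ U M :=
  letI := cmod M
  ⟨fun a u m => by rw [Algebra.smul_def, mul_smul]; rfl⟩

/-- The homomorphism of `U`-modules from the model determined by a highest weight vector. -/
def IsHighestWeight.lift {hh : ℂ} {v : M} (hv : IsHighestWeight hh v) : Model hh →ₗ[U] M :=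
  letI := cmod M
  haveI := cmod_isScalarTower M
  { toFun := toLinear hh v
    map_add' := map_add _
    map_smul' := hv.toLinear_smul }

theorem IsHighestWeight.lift_mon {hh : ℂ} {v : M} (hv : IsHighestWeight hh v) (i j : ℕ) :
    hv.lift (Model.mon hh i j) = F ^ i • Q ^ j • v :=
  letI := cmod M
  toLinear_mon hh v i j

theorem IsHighestWeight.lift_mon_zero {hh : ℂ} {v : M} (hv : IsHighestWeight hh v) :
    hv.lift (Model.mon hh 0 0) = v := by
  simp [lift_mon]

namespace Model

theorem isHighestWeight_mon (hh : ℂ) : IsHighestWeight hh (mon hh 0 0) where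
  E_smul := E_smul_mon_zero 0
  P_smul := P_smul_mon_zero 0
  H_smul := by rw [sc_smul, H_smul_mon]; simp
  Z_smul := Z_smul _

theorem mon_eq_smul (hh : ℂ) (i j : ℕ) : mon hh i j = F ^ i • Q ^ j • mon hh 0 0 := by
  induction i with
  | zero =>
    induction j with
    | zero => simp
    | succ j ih =>
      simp only [pow_zero, one_smul] at ih ⊢
      rw [pow_succ', mul_smul, ← ih, Q_smul_mon]
  | succ i ih => rw [pow_succ', mul_smul, ← ih, F_smul_mon]

theorem span_mon (hh : ℂ) : Submodule.span U {mon hh 0 0} = ⊤ := by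
  refine eq_top_iff.mpr fun m _ => ?_
  induction m using Model.induction with
  | zero => exact zero_mem _
  | add x y hx hy => exact add_mem (hx trivial) (hy trivial)
  | smul_mon a i j =>
    rw [← sc_smul, mon_eq_smul hh i j]
    exact Submodule.smul_mem _ _ (Submodule.smul_mem _ _ (Submodule.smul_mem _ _
      (Submodule.mem_span_singleton_self _)))

theorem hom_ext {hh : ℂ} {f g : Model hh →ₗ[U] M} (h : f (mon hh 0 0) = g (mon hh 0 0)) :
    f = g :=
  LinearMap.ext_on (span_mon hh) (by simpa using h)

theorem isHighestWeight_Q_smul {hh : ℂ} : IsHighestWeight (hh - 1) (Q • mon hh 0 0) where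
  E_smul := by rw [Q_smul_mon, E_smul_mon_zero]
  P_smul := by rw [Q_smul_mon, P_smul_mon_zero]
  H_smul := by rw [Q_smul_mon, sc_smul, H_smul_mon]; simp
  Z_smul := Z_smul _

/-- The map from the model of highest weight `hh - 1` given by multiplication by `q`. -/
def shift (hh : ℂ) : Model (hh - 1) →ₗ[U] Model hh := (isHighestWeight_Q_smul (hh := hh)).lift

theorem shift_mon (hh : ℂ) (i j : ℕ) : shift hh (mon (hh - 1) i j) = mon hh i (j + 1) := by
  rw [shift, IsHighestWeight.lift_mon, mon_eq_smul hh i (j + 1), pow_succ, mul_smul]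

theorem shift_apply (hh : ℂ) (m : Model (hh - 1)) (i j : ℕ) :
    (show ℕ × ℕ →₀ ℂ from shift hh m) (i, j + 1) = (show ℕ × ℕ →₀ ℂ from m) (i, j) := by
  induction m using Model.induction with
  | zero => rw [map_zero]; rfl
  | add x y hx hy => rw [map_add]; exact congrArg₂ (· + ·) hx hy
  | smul_mon a i' j' =>
    rw [← sc_smul, map_smul, sc_smul, sc_smul, shift_mon]
    change a * (Finsupp.single (i', j' + 1) (1 : ℂ) : ℕ × ℕ →₀ ℂ) (i, j + 1) =
      a * (Finsupp.single (i', j') (1 : ℂ) : ℕ × ℕ →₀ ℂ) (i, j)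
    simp [Finsupp.single_apply]

theorem shift_injective (hh : ℂ) : Function.Injective (shift hh) := by
  intro x y h
  refine Finsupp.ext fun ⟨i, j⟩ => ?_
  have hx := shift_apply hh x i j
  rw [h] at hx
  exact hx.symm.trans (shift_apply hh y i j)

end Model

/-! ### Verma modules of central charge zero -/

theorem isHighestWeight_hwVec (hh : ℂ) : IsHighestWeight hh (hwVec hh 0) := by
  have key {u : U} (hu : u ∈ ({E, P, H - sc hh, Z - sc 0} : Set U)) : u • hwVec hh 0 = 0 := by
    rw [hwVec, ← Submodule.Quotient.mk_smul, smul_eq_mul, mul_one, Submodule.Quotient.mk_eq_zero]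
    exact Submodule.subset_span hu
  refine ⟨key (by simp), key (by simp), ?_, ?_⟩
  · rw [← sub_eq_zero, ← sub_smul]
    exact key (by simp)
  · have h : Z = Z - sc 0 := by simp [sc]
    rw [h]
    exact key (by simp)

/-- The map from the Verma module to its model. -/
def vermaToModel (hh : ℂ) : Verma hh 0 →ₗ[U] Model hh :=
  (vermaIdeal hh 0).liftQ (LinearMap.toSpanSingleton U (Model hh) (Model.mon hh 0 0)) <| by
    have h := Model.isHighestWeight_mon hh
    rw [vermaIdeal, Submodule.span_le]
    rintro u (rfl | rfl | rfl | rfl)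
    · simpa using h.E_smul
    · simpa using h.P_smul
    · simpa [sub_smul, sub_eq_zero] using h.H_smul
    · simpa [sc] using h.Z_smul

theorem vermaToModel_hwVec (hh : ℂ) : vermaToModel hh (hwVec hh 0) = Model.mon hh 0 0 := by
  simp [vermaToModel, hwVec]

/-- The Verma module of central charge zero is isomorphic to its model. -/
def vermaEquiv (hh : ℂ) : Verma hh 0 ≃ₗ[U] Model hh :=
  LinearEquiv.ofLinearMap (vermaToModel hh) (isHighestWeight_hwVec hh).lift
    (Model.hom_ext (by
      rw [LinearMap.comp_apply, IsHighestWeight.lift_mon_zero, vermaToModel_hwVec,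
        LinearMap.id_apply]))
    (by
      refine Submodule.linearMap_qext _ (LinearMap.ext_ring ?_)
      change (isHighestWeight_hwVec hh).lift (vermaToModel hh (hwVec hh 0)) = hwVec hh 0
      rw [vermaToModel_hwVec, IsHighestWeight.lift_mon_zero])

theorem exists_verma_embedding (hh : ℂ) :
    ∃ φ : Verma (hh - 1) 0 →ₗ[U] Verma hh 0,
      Function.Injective φ ∧ φ (hwVec (hh - 1) 0) = Q • hwVec hh 0 := by
  refine ⟨(vermaEquiv hh).symm.toLinearMap ∘ₗ Model.shift hh ∘ₗ (vermaEquiv (hh - 1)).toLinearMap,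
    (vermaEquiv hh).symm.injective.comp
      ((Model.shift_injective hh).comp (vermaEquiv (hh - 1)).injective), ?_⟩
  change (vermaEquiv hh).symm (Model.shift hh (vermaToModel (hh - 1) (hwVec (hh - 1) 0))) = _
  rw [vermaToModel_hwVec, LinearEquiv.symm_apply_eq, map_smul, Model.shift_mon]
  change _ = Q • vermaToModel hh (hwVec hh 0)
  rw [vermaToModel_hwVec, Model.Q_smul_mon]

end Lift

/-! ### The models belong to the block -/

namespace Model

theorem isWeightVec_smul_mon (hh a : ℂ) (i j : ℕ) :
    IsWeightVec (hh - 2 * i - j) 0 (a • mon hh i j) := by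
  constructor
  · rw [sc_smul, smul_comm, H_smul_mon, smul_comm]
  · rw [Z_smul, sc_smul, zero_smul]

theorem exists_finiteDimensional (hh : ℂ) (v : Model hh) :
    ∃ W : Submodule ℂ (Model hh), FiniteDimensional ℂ W ∧ ∀ u ∈ nPlus, u • v ∈ W := by
  let S (d : ℕ) : Set (Model hh) := (fun x : ℕ × ℕ => mon hh x.1 x.2) '' {x | x.1 + x.2 ≤ d}
  have hS (d : ℕ) : (S d).Finite :=
    (((Set.finite_Iic d).prod (Set.finite_Iic d)).subset fun x hx => by
      simp only [Set.mem_ofPred_eq] at hx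
      simp only [Set.mem_prod, Set.mem_Iic]
      omega).image _
  have mono {d d' : ℕ} (h : d ≤ d') : Submodule.span ℂ (S d) ≤ Submodule.span ℂ (S d') :=
    Submodule.span_mono (Set.image_mono fun x (hx : x.1 + x.2 ≤ d) => hx.trans h)
  have mem {d i j : ℕ} (h : i + j ≤ d) : mon hh i j ∈ Submodule.span ℂ (S d) :=
    Submodule.subset_span ⟨(i, j), h, rfl⟩
  obtain ⟨d, hd⟩ : ∃ d, v ∈ Submodule.span ℂ (S d) := by
    induction v using Model.induction with
    | zero => exact ⟨0, zero_mem _⟩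
    | add x y hx hy =>
      obtain ⟨d, hd⟩ := hx
      obtain ⟨d', hd'⟩ := hy
      exact ⟨max d d', add_mem (mono (le_max_left _ _) hd) (mono (le_max_right _ _) hd')⟩
    | smul_mon a i j => exact ⟨i + j, Submodule.smul_mem _ _ (mem le_rfl)⟩
  have stable {u : U} (hu : ∀ i j, i + j ≤ d → u • mon hh i j ∈ Submodule.span ℂ (S d))
      (w : Model hh) (hw : w ∈ Submodule.span ℂ (S d)) : u • w ∈ Submodule.span ℂ (S d) := by
    induction hw using Submodule.span_induction with
    | mem x hx => obtain ⟨⟨i, j⟩, h, rfl⟩ := hx; exact hu i j h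
    | zero => rw [smul_zero]; exact zero_mem _
    | add x y _ _ hx hy => rw [smul_add]; exact add_mem hx hy
    | smul a x _ hx => rw [smul_comm]; exact Submodule.smul_mem _ _ hx
  refine ⟨Submodule.span ℂ (S d), FiniteDimensional.span_of_finite ℂ (hS d), fun u hu => ?_⟩
  suffices ∀ w ∈ Submodule.span ℂ (S d), u • w ∈ Submodule.span ℂ (S d) from this v hd
  induction hu using Algebra.adjoin_induction with
  | mem x hx =>
    obtain rfl | rfl := hx
    · refine stable fun i j h => ?_
      cases i with
      | zero => rw [E_smul_mon_zero]; exact zero_mem _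
      | succ i =>
        rw [E_smul_mon_succ]
        exact Submodule.smul_mem _ _ (mem (by omega))
    · refine stable fun i j h => ?_
      cases i with
      | zero => rw [P_smul_mon_zero]; exact zero_mem _
      | succ i =>
        rw [P_smul_mon_succ]
        exact Submodule.smul_mem _ _ (mem (by omega))
  | algebraMap a => exact fun w hw => by rw [algebraMap_smul]; exact Submodule.smul_mem _ _ hw
  | add a b _ _ ha hb => exact fun w hw => by rw [add_smul]; exact add_mem (ha w hw) (hb w hw)
  | mul a b _ _ ha hb => exact fun w hw => by rw [mul_smul]; exact ha _ (hb w hw)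

theorem inO (hh : ℂ) : InO (Model hh) := by
  refine ⟨⟨⟨{mon hh 0 0}, by simpa using span_mon hh⟩⟩, fun v => ?_, ?_⟩
  · induction v using Model.induction with
    | zero => exact zero_mem _
    | add x y hx hy => exact add_mem hx hy
    | smul_mon a i j =>
      exact AddSubgroup.subset_closure ⟨_, _, isWeightVec_smul_mon hh a i j⟩
  · rw [cmod_eq]
    exact exists_finiteDimensional hh

theorem exists_weight {hh hh' zz' : ℂ} {v : Model hh} (hv : v ≠ 0)
    (hw : IsWeightVec hh' zz' v) : zz' = 0 ∧ ∃ i j : ℕ, hh' = hh - 2 * i - j := by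
  obtain ⟨hH, hZ⟩ := hw
  rw [Z_smul, sc_smul] at hZ
  refine ⟨(smul_eq_zero.mp hZ.symm).resolve_right hv, ?_⟩
  obtain ⟨⟨i, j⟩, hx⟩ := Finsupp.ne_iff.mp hv
  refine ⟨i, j, ?_⟩
  have h := H_smul_apply v (i, j)
  rw [hH, sc_smul] at h
  exact mul_right_cancel₀ hx h

theorem inBlock (hh0 : ℂ) (n : ℤ) : InBlock hh0 0 (ModuleCat.of U (Model (hh0 + n))) := by
  refine ⟨inO _, fun v hh zz hv hw => ?_⟩
  obtain ⟨hz, i, j, h⟩ := exists_weight (hh := hh0 + n) hv hw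
  refine ⟨hz, n - 2 * i - j, ?_⟩
  rw [h]
  push_cast
  ring

/-- The model is an indecomposable module. -/
theorem eq_top_or_eq_top_of_isCompl {hh : ℂ} {N₁ N₂ : Submodule U (Model hh)}
    (h : IsCompl N₁ N₂) : N₁ = ⊤ ∨ N₂ = ⊤ := by
  have top {N : Submodule U (Model hh)} (hN : mon hh 0 0 ∈ N) : N = ⊤ :=
    top_unique <| (span_mon hh).symm.trans_le <| (Submodule.span_singleton_le_iff_mem _ _).mpr hN
  obtain ⟨a, ha, b, hb, hab⟩ :=
    Submodule.mem_sup.mp (h.sup_eq_top.symm ▸ Submodule.mem_top : mon hh 0 0 ∈ N₁ ⊔ N₂)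
  have hH : H • a = sc hh • a := by
    rw [← sub_eq_zero, ← Submodule.mem_bot U, ← h.inf_eq_bot]
    refine ⟨sub_mem (N₁.smul_mem _ ha) (N₁.smul_mem _ ha), ?_⟩
    have h' : H • a - sc hh • a = sc hh • b - H • b := by
      rw [sub_eq_sub_iff_add_eq_add, ← smul_add, ← smul_add, add_comm b a, hab]
      exact (isHighestWeight_mon hh).H_smul
    rw [h']
    exact sub_mem (N₂.smul_mem _ hb) (N₂.smul_mem _ hb)
  have hsupp (x : ℕ × ℕ) (hx : x ≠ (0, 0)) : (show ℕ × ℕ →₀ ℂ from a) x = 0 := by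
    have h' := H_smul_apply a x
    rw [hH, sc_smul] at h'
    replace h' : hh * (show ℕ × ℕ →₀ ℂ from a) x =
      (hh - 2 * x.1 - x.2) * (show ℕ × ℕ →₀ ℂ from a) x := h'
    have h'' : ((2 * x.1 + x.2 : ℕ) : ℂ) * (show ℕ × ℕ →₀ ℂ from a) x = 0 := by
      push_cast
      linear_combination h'
    refine (mul_eq_zero.mp h'').resolve_left fun h0 => hx ?_
    rw [Nat.cast_eq_zero] at h0
    ext <;> simp <;> omega
  have ha' : a = (show ℕ × ℕ →₀ ℂ from a) (0, 0) • mon hh 0 0 := by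
    refine Finsupp.ext fun x => ?_
    change _ = (show ℕ × ℕ →₀ ℂ from a) (0, 0) * (Finsupp.single (0, 0) (1 : ℂ) : ℕ × ℕ →₀ ℂ) x
    by_cases hx : x = (0, 0)
    · rw [hx, Finsupp.single_eq_same, mul_one]
    · rw [hsupp x hx, Finsupp.single_eq_of_ne hx, mul_zero]
  generalize (show ℕ × ℕ →₀ ℂ from a) (0, 0) = c at ha'
  by_cases hc : c = 0
  · rw [ha', hc, zero_smul, zero_add] at hab
    exact Or.inr (top (hab ▸ hb))
  · refine Or.inl (top ?_)
    have : mon hh 0 0 = sc c⁻¹ • a := by rw [ha', sc_smul, inv_smul_smul₀ hc]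
    rw [this]
    exact N₁.smul_mem _ ha

theorem exists_hom_ne_zero (hh0 : ℂ) (n : ℤ) :
    ∃ f : Model (hh0 + (n - 1 : ℤ)) →ₗ[U] Model (hh0 + n), f ≠ 0 := by
  have h : hh0 + ((n - 1 : ℤ) : ℂ) = hh0 + n - 1 := by push_cast; ring
  rw [h]
  refine ⟨shift _, fun h0 => mon_ne_zero (hh0 + n) 0 1 ?_⟩
  rw [← shift_mon, h0, LinearMap.zero_apply]

end Model

/-! ### Existence of highest weight vectors -/

section HighestWeight

variable {M : Type} [AddCommGroup M] [Module U M]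

theorem exists_pow_smul_ne_zero {T : U} {w : M} (hw : w ≠ 0) (h : ∃ k : ℕ, T ^ k • w = 0) :
    ∃ k : ℕ, T ^ k • w ≠ 0 ∧ T • T ^ k • w = 0 := by
  classical
  obtain ⟨k, hk⟩ : ∃ k, Nat.find h = k + 1 :=
    Nat.exists_eq_succ_of_ne_zero fun h0 => hw (by simpa [h0] using Nat.find_spec h)
  refine ⟨k, Nat.find_min h (by omega), ?_⟩
  have := Nat.find_spec h
  rwa [hk, pow_succ', mul_smul] at this

variable [Module ℂ M] [IsScalarTower ℂ U M]

theorem H_smul_pow_smul {T : U} {c : ℂ} (hT : H * T = T * H + sc c * T) {hh : ℂ} {w : M}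
    (hw : H • w = hh • w) (k : ℕ) : H • T ^ k • w = (hh + k * c) • T ^ k • w := by
  induction k with
  | zero => simpa using hw
  | succ k ih =>
    rw [pow_succ', mul_smul, ← mul_smul, hT, add_smul, mul_smul, ih, mul_smul, sc, algebraMap_smul,
      smul_comm T]
    generalize T • T ^ k • w = x
    push_cast
    module

theorem exists_pow_smul_eq_zero {T : U} {c : ℂ} (hc : c ≠ 0) (hT : H * T = T * H + sc c * T)
    {hh : ℂ} {w : M} (hw : H • w = hh • w) {W : Submodule ℂ M} [FiniteDimensional ℂ W]
    (hW : ∀ k : ℕ, T ^ k • w ∈ W) : ∃ k : ℕ, T ^ k • w = 0 := by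
  by_contra! hne
  have hli : LinearIndependent ℂ fun k : ℕ => T ^ k • w :=
    Module.End.eigenvectors_linearIndependent' (DistribSMul.toLinearMap ℂ M H)
      (fun k : ℕ => hh + k * c)
      (fun k l h => by simpa [hc] using h) _
      fun k => ⟨Module.End.mem_eigenspace_iff.mpr (H_smul_pow_smul hT hw k), hne k⟩
  have hli' : LinearIndependent ℂ fun k : ℕ => (⟨T ^ k • w, hW k⟩ : W) :=
    LinearIndependent.of_comp W.subtype hli
  exact not_finite_iff_infinite.mpr (inferInstanceAs (Infinite ℕ)) hli'.finite_of_isNoetherian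

theorem exists_isHighestWeight_of_finiteDimensional {hh : ℂ} {w : M} (hw0 : w ≠ 0)
    (hH : H • w = hh • w) (hZ : Z • w = 0) {W : Submodule ℂ M} [FiniteDimensional ℂ W]
    (hW : ∀ u ∈ nPlus, u • w ∈ W) :
    ∃ (k : ℕ) (v : M), v ≠ 0 ∧ IsHighestWeight (hh + k) v := by
  have hE : E ∈ nPlus := Algebra.subset_adjoin (by simp)
  have hP : P ∈ nPlus := Algebra.subset_adjoin (by simp)
  have hHE : H * E = E * H + sc 2 * E := by rw [H_mul_E, sc, map_ofNat]
  have hHP : H * P = P * H + sc 1 * P := by rw [H_mul_P, sc, map_one, one_mul]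
  obtain ⟨k, hk, hEk⟩ := exists_pow_smul_ne_zero hw0 <|
    exists_pow_smul_eq_zero two_ne_zero hHE hH fun k => hW _ (pow_mem hE k)
  have hHk := H_smul_pow_smul hHE hH k
  obtain ⟨l, hl, hPl⟩ := exists_pow_smul_ne_zero hk <|
    exists_pow_smul_eq_zero one_ne_zero hHP hHk fun l => by
      rw [← mul_smul]
      exact hW _ (mul_mem (pow_mem hP l) (pow_mem hE k))
  refine ⟨2 * k + l, _, hl, ⟨?_, hPl, ?_, ?_⟩⟩
  · rw [← mul_smul, ((show Commute E P from E_mul_P).pow_right l).eq, mul_smul, hEk, smul_zero]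
  · rw [H_smul_pow_smul hHP hHk, sc, algebraMap_smul]
    congr 1
    push_cast
    ring
  · rw [Z_smul_comm, Z_smul_comm, hZ, smul_zero, smul_zero]

end HighestWeight

theorem exists_isHighestWeight {hh0 : ℂ} {M : ModuleCat.{0} U} (hM : InBlock hh0 0 M)
    [Nontrivial M] : ∃ (n : ℤ) (v : M), v ≠ 0 ∧ IsHighestWeight (hh0 + n) v := by
  let := cmod M
  have := cmod_isScalarTower M
  obtain ⟨w, hw0, hh, zz, hw⟩ : ∃ w : M, w ≠ 0 ∧ ∃ hh zz, IsWeightVec hh zz w := by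
    by_contra! h
    obtain ⟨x, hx⟩ := exists_ne (0 : M)
    have hle : AddSubgroup.closure {w : M | ∃ hh zz : ℂ, IsWeightVec hh zz w} ≤ ⊥ := by
      rw [AddSubgroup.closure_le]
      rintro w ⟨hh, zz, hw⟩
      by_contra hw0
      exact h w hw0 hh zz hw
    exact hx (AddSubgroup.mem_bot.mp (hle (hM.1.2.1 x)))
  obtain ⟨rfl, n, rfl⟩ := hM.2 w hh zz hw0 hw
  obtain ⟨W, hWfin, hW⟩ := hM.1.2.2 w
  obtain ⟨k, v, hv0, hv⟩ := exists_isHighestWeight_of_finiteDimensional hw0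
    (hw.1.trans (algebraMap_smul U _ w)) (hw.2.trans (by simp [sc])) hW
  refine ⟨n + k, v, hv0, ?_⟩
  push_cast
  rwa [← add_assoc]

/-! ### Indecomposability of the block -/

/-- The class `A` contains a copy of the model of highest weight `hh`. -/
def ContainsModel (A : ModuleCat.{0} U → Prop) (hh : ℂ) : Prop :=
  ∃ X : ModuleCat.{0} U, A X ∧ Nonempty (X ≃ₗ[U] Model hh)

theorem ContainsModel.hom_eq_zero {A B : ModuleCat.{0} U → Prop}
    (hAB : ∀ X Y : ModuleCat.{0} U, A X → B Y → ∀ f : X →ₗ[U] Y, f = 0) {hh : ℂ}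
    (hA : ContainsModel A hh) {Y : ModuleCat.{0} U} (hY : B Y) (f : Model hh →ₗ[U] Y) : f = 0 := by
  obtain ⟨X, hX, ⟨e⟩⟩ := hA
  have h := hAB X Y hX hY (f ∘ₗ e.toLinearMap)
  ext m
  simpa using LinearMap.congr_fun h (e.symm m)

theorem ContainsModel.hom_model_eq_zero {A B : ModuleCat.{0} U → Prop}
    (hAB : ∀ X Y : ModuleCat.{0} U, A X → B Y → ∀ f : X →ₗ[U] Y, f = 0) {hh hh' : ℂ}
    (hA : ContainsModel A hh) (hB : ContainsModel B hh') (f : Model hh →ₗ[U] Model hh') :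
    f = 0 := by
  obtain ⟨Y, hY, ⟨e⟩⟩ := hB
  have h := hA.hom_eq_zero hAB hY (e.symm.toLinearMap ∘ₗ f)
  ext m
  simpa using LinearMap.congr_fun h m

theorem not_containsModel {hh0 : ℂ} {A B : ModuleCat.{0} U → Prop}
    (hB : ∀ M, B M → InBlock hh0 0 M) (hBne : ∃ M, B M ∧ Nontrivial M)
    (hdec : ∀ n : ℤ, ContainsModel A (hh0 + n) ∨ ContainsModel B (hh0 + n))
    (hAB : ∀ X Y : ModuleCat.{0} U, A X → B Y → ∀ f : X →ₗ[U] Y, f = 0)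
    (hBA : ∀ X Y : ModuleCat.{0} U, B X → A Y → ∀ f : X →ₗ[U] Y, f = 0) (n : ℤ) :
    ¬ ContainsModel A (hh0 + n) := by
  intro hn
  have all (m : ℤ) : ContainsModel A (hh0 + m) := by
    induction m using Int.inductionOn' (b := n) with
    | zero => exact hn
    | succ k _ ih =>
      refine (hdec _).resolve_right fun hk => ?_
      have h := Model.exists_hom_ne_zero hh0 (k + 1)
      rw [add_sub_cancel_right] at h
      obtain ⟨f, hf⟩ := h
      exact hf (ih.hom_model_eq_zero hAB hk f)
    | pred k _ ih =>
      refine (hdec _).resolve_right fun hk => ?_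
      obtain ⟨f, hf⟩ := Model.exists_hom_ne_zero hh0 k
      exact hf (hk.hom_model_eq_zero hBA ih f)
  obtain ⟨Y, hY, hYne⟩ := hBne
  obtain ⟨m, v, hv0, hv⟩ := exists_isHighestWeight (hB Y hY)
  apply hv0
  rw [← hv.lift_mon_zero, (all m).hom_eq_zero hAB hY hv.lift, LinearMap.zero_apply]

end
end Schrodinger

namespace Schrodinger

open CategoryTheory

/-- Lemma 11 of the paper: let `ξ ∈ 𝔥*/ℤR` have zero central
charge, represented by a weight with `λ(h) = hh0` and `λ(z) = 0`. Then:
(i) for every `λ ∈ ξ` there is an injective homomorphism of `U`-modules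
`Δ(λ - h✓) ↪ Δ(λ)` sending the highest weight generator `v_{λ-h✓}` to `q·v_λ`;
(ii) the block `O[ξ]` is indecomposable: it cannot be written as a direct sum of
two nonzero subcategories (i.e. there are no two classes of objects of `O[ξ]`,
each containing a nonzero module, such that every object of `O[ξ]` is the
internal direct sum of a submodule from the first class and one from the second,
and such that all `U`-module homomorphisms between members of the two classes
vanish). -/
theorem zero_charge_verma_embedding_and_block_indecomposable (hh0 : ℂ) :
    (∀ hh : ℂ, (∃ n : ℤ, hh = hh0 + n) →
      ∃ φ : Verma (hh - 1) 0 →ₗ[U] Verma hh 0,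
        Function.Injective φ ∧ φ (hwVec (hh - 1) 0) = Q • hwVec hh 0) ∧
    ¬ ∃ A B : ModuleCat.{0} U → Prop,
        (∀ M, A M → InBlock hh0 0 M) ∧
        (∀ M, B M → InBlock hh0 0 M) ∧
        (∃ M, A M ∧ Nontrivial M) ∧
        (∃ M, B M ∧ Nontrivial M) ∧
        (∀ M : ModuleCat.{0} U, InBlock hh0 0 M →
          ∃ N₁ N₂ : Submodule U M, IsCompl N₁ N₂ ∧
            A (ModuleCat.of U N₁) ∧ B (ModuleCat.of U N₂)) ∧
        (∀ X Y : ModuleCat.{0} U, A X → B Y → ∀ f : X →ₗ[U] Y, f = 0) ∧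
        (∀ X Y : ModuleCat.{0} U, B X → A Y → ∀ f : X →ₗ[U] Y, f = 0) := by
  refine ⟨fun hh _ => exists_verma_embedding hh, ?_⟩
  rintro ⟨A, B, hA, hB, hAne, hBne, hdec, hAB, hBA⟩
  have hmodel (n : ℤ) : ContainsModel A (hh0 + n) ∨ ContainsModel B (hh0 + n) := by
    obtain ⟨N₁, N₂, hN, h₁, h₂⟩ := hdec _ (Model.inBlock hh0 n)
    refine (Model.eq_top_or_eq_top_of_isCompl hN).imp (fun h => ?_) (fun h => ?_)
    · exact ⟨_, h₁, ⟨LinearEquiv.ofTop N₁ h⟩⟩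
    · exact ⟨_, h₂, ⟨LinearEquiv.ofTop N₂ h⟩⟩
  exact (hmodel 0).elim (not_containsModel hB hBne hmodel hAB hBA 0)
    (not_containsModel hA hAne (fun n => (hmodel n).symm) hBA hAB 0)

end Schrodinger
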